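/- Let (W,S) be a Coxeter system of rank n whose associated bilinear form has signature (n-1,1). Let W' be a special subgroup of W (generated by a subset S' ⊆ S) whose associated bilinear form has signature (|S'|-1,1) and whose normalized action on its own phase space is cocompact. Then the limit set Λ(W') of W' is canonically embedded into the limit set Λ(W) of W: via the Cannon–Thurston map of (W,S), Λ(W') is identified with Λ(W) ∩ conv(Δ̂'), where Δ' ⊆ Δ are the simple roots corresponding to S'. -/

import Mathlib

/-!
STATEMENT 18: Let (W,S) be a Coxeter system of rank n whose associated bilinear form has
signature (n-1,1).  Let W' be a special subgroup (generated by S' ⊆ S) whose associated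
bilinear form (the restriction of B) has signature (|S'|-1,1) and whose normalized action
on its own phase space is cocompact.  Then the limit set Λ(W') is canonically embedded into
Λ(W): it is identified (via the canonical inclusion, i.e. via the Cannon–Thurston map of
(W,S)) with Λ(W) ∩ conv(Δ̂').
-/

open Matrix Filter Set

noncomputable section

/-- The bilinear form associated to the matrix `B`. -/
def bform {ι : Type*} [Fintype ι] (B : Matrix ι ι ℝ) (u v : ι → ℝ) : ℝ :=
  u ⬝ᵥ B.mulVec v

/-- `|v|₁ = ∑ i, oᵢ vᵢ`. -/
def l1 {ι : Type*} [Fintype ι] (o v : ι → ℝ) : ℝ := ∑ i, o i * v i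

/-- The normalization `v̂ = v / |v|₁`. -/
def nrm {ι : Type*} [Fintype ι] (o v : ι → ℝ) : ι → ℝ := (l1 o v)⁻¹ • v

/-- Extension by zero of a vector indexed by a subset of coordinates. -/
def ext0 {n : ℕ} (Δ' : Finset (Fin n)) (v : {i // i ∈ Δ'} → ℝ) : Fin n → ℝ :=
  fun i => if h : i ∈ Δ' then v ⟨i, h⟩ else 0

section BilinearForm

variable {ι : Type*} [Fintype ι] {B : Matrix ι ι ℝ}

lemma bform_add_left (u v w : ι → ℝ) : bform B (u + v) w = bform B u w + bform B v w := by
  simp [bform, add_dotProduct]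

lemma bform_add_right (u v w : ι → ℝ) : bform B u (v + w) = bform B u v + bform B u w := by
  simp [bform, mulVec_add]

lemma bform_sub_left (u v w : ι → ℝ) : bform B (u - v) w = bform B u w - bform B v w := by
  simp [bform, sub_dotProduct]

lemma bform_sub_right (u v w : ι → ℝ) : bform B u (v - w) = bform B u v - bform B u w := by
  simp [bform, mulVec_sub]

lemma bform_smul_left (a : ℝ) (u v : ι → ℝ) : bform B (a • u) v = a * bform B u v := by
  simp [bform]

lemma bform_smul_right (a : ℝ) (u v : ι → ℝ) : bform B u (a • v) = a * bform B u v := by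
  simp [bform, mulVec_smul]

lemma bform_comm (hB : B.IsHermitian) (u v : ι → ℝ) : bform B u v = bform B v u := by
  have hT : Bᵀ = B := by simpa [IsHermitian, conjTranspose_eq_transpose_of_trivial] using hB
  rw [bform, dotProduct_mulVec, ← mulVec_transpose, hT, dotProduct_comm, bform]

lemma bform_single_left [DecidableEq ι] (i : ι) (v : ι → ℝ) :
    bform B (Pi.single i 1) v = (B *ᵥ v) i := by
  simp [bform]

lemma bform_single_single [DecidableEq ι] (i j : ι) :
    bform B (Pi.single i 1) (Pi.single j 1) = B i j := by
  simp [bform]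

lemma continuous_bform_self : Continuous fun v : ι → ℝ => bform B v v := by
  unfold bform
  fun_prop

lemma l1_add (o u v : ι → ℝ) : l1 o (u + v) = l1 o u + l1 o v := by
  simp [l1, mul_add, Finset.sum_add_distrib]

lemma l1_sub (o u v : ι → ℝ) : l1 o (u - v) = l1 o u - l1 o v := by
  simp [l1, mul_sub, Finset.sum_sub_distrib]

lemma l1_smul (o : ι → ℝ) (a : ℝ) (v : ι → ℝ) : l1 o (a • v) = a * l1 o v := by
  simp only [l1, Pi.smul_apply, smul_eq_mul, Finset.mul_sum]
  exact Finset.sum_congr rfl fun i _ => by ring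

lemma l1_single [DecidableEq ι] (o : ι → ℝ) (i : ι) : l1 o (Pi.single i 1) = o i := by
  simp [l1, Pi.single_apply]

lemma continuous_l1 (o : ι → ℝ) : Continuous (l1 o) := by
  unfold l1
  fun_prop

lemma l1_mono {o u v : ι → ℝ} (ho : ∀ i, 0 < o i) (h : u ≤ v) : l1 o u ≤ l1 o v :=
  Finset.sum_le_sum fun i _ => mul_le_mul_of_nonneg_left (h i) (ho i).le

lemma l1_nonneg {o v : ι → ℝ} (ho : ∀ i, 0 < o i) (h : 0 ≤ v) : 0 ≤ l1 o v :=
  Finset.sum_nonneg fun i _ => mul_nonneg (ho i).le (h i)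

lemma l1_pos {o v : ι → ℝ} (ho : ∀ i, 0 < o i) (h : 0 ≤ v) (hv : v ≠ 0) : 0 < l1 o v := by
  obtain ⟨i, hi⟩ := Function.ne_iff.1 hv
  exact Finset.sum_pos' (fun i _ => mul_nonneg (ho i).le (h i))
    ⟨i, Finset.mem_univ i, mul_pos (ho i) (lt_of_le_of_ne (h i) (Ne.symm hi))⟩

lemma l1_nrm {o v : ι → ℝ} (h : l1 o v ≠ 0) : l1 o (nrm o v) = 1 := by
  rw [nrm, l1_smul, inv_mul_cancel₀ h]

lemma nrm_eq_self {o v : ι → ℝ} (h : l1 o v = 1) : nrm o v = v := by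
  rw [nrm, h, inv_one, one_smul]

lemma nrm_smul (o : ι → ℝ) {a : ℝ} (ha : a ≠ 0) (v : ι → ℝ) : nrm o (a • v) = nrm o v := by
  rw [nrm, nrm, l1_smul, smul_smul, mul_inv, mul_right_comm, inv_mul_cancel₀ ha, one_mul]

lemma continuousAt_nrm {o v : ι → ℝ} (h : l1 o v ≠ 0) : ContinuousAt (nrm o) v := by
  unfold nrm
  exact ((continuous_l1 o).continuousAt.inv₀ h).smul continuousAt_id

lemma bform_nrm (o u v : ι → ℝ) :
    bform B (nrm o u) (nrm o v) = bform B u v / (l1 o u * l1 o v) := by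
  rw [nrm, nrm, bform_smul_left, bform_smul_right, div_eq_mul_inv, mul_inv]
  ring

lemma bform_right_of_eigenvector {o : ι → ℝ} {lam : ℝ} (ho : B *ᵥ o = lam • o) (v : ι → ℝ) :
    bform B v o = lam * l1 o v := by
  rw [bform, ho, dotProduct_smul, dotProduct_comm]
  rfl

lemma bform_self_sub (hB : B.IsHermitian) (u v : ι → ℝ) :
    bform B (u - v) (u - v) = bform B u u - 2 * bform B u v + bform B v v := by
  rw [bform_sub_left, bform_sub_right, bform_sub_right, bform_comm hB v u]
  ring

/-- A reverse Cauchy–Schwarz type estimate for forms that are nonnegative on `{l1 o = 0}`. -/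
lemma reverse_cauchy_schwarz (hB : B.IsHermitian) {o : ι → ℝ}
    (hpos : ∀ v, l1 o v = 0 → 0 ≤ bform B v v) {u z : ι → ℝ}
    (hu : bform B u u ≤ 0) (hu1 : 0 < l1 o u) (hz1 : 0 < l1 o z) :
    l1 o u * (-bform B z z / (2 * l1 o z)) ≤ -bform B u z := by
  have h := hpos (u - (l1 o u / l1 o z) • z) (by
    rw [l1_sub, l1_smul, div_mul_cancel₀ _ hz1.ne', sub_self])
  rw [bform_self_sub hB, bform_smul_left, bform_smul_right, bform_smul_right] at h
  set t := l1 o u / l1 o z with ht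
  have htpos : 0 < t := div_pos hu1 hz1
  have e : l1 o u * (-bform B z z / (2 * l1 o z)) = t * (-bform B z z) / 2 := by
    rw [ht]; field_simp
  rw [e]
  have : 0 ≤ t * (-2 * bform B u z + t * bform B z z) := by nlinarith
  have := nonneg_of_mul_nonneg_right this htpos
  linarith

lemma exists_pos_le_of_forall_pos {f : ι → ℝ} {p : ι → Prop} (h : ∀ i, p i → 0 < f i) :
    ∃ c : ℝ, 0 < c ∧ ∀ i, p i → c ≤ f i := by
  have : ∀ᶠ c : ℝ in nhdsWithin 0 (Ioi 0), ∀ i, p i → c ≤ f i := by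
    refine eventually_all.2 fun i => ?_
    by_cases hi : p i
    · filter_upwards [mem_nhdsWithin_of_mem_nhds (Iio_mem_nhds (h i hi))] with c hc _
      exact le_of_lt hc
    · exact Eventually.of_forall fun _ h => absurd h hi
  obtain ⟨c, hc, hc0⟩ := (this.and self_mem_nhdsWithin).exists
  exact ⟨c, hc0, hc⟩

/-- If `B` has signature `(N - 1, 1)` and `o` is an eigenvector with negative eigenvalue, then
`B` is positive definite on the orthogonal complement of `o`. -/
lemma exists_coercive_const [DecidableEq ι] (hB : B.IsHermitian)
    (hneg : Nat.card {i // hB.eigenvalues i < 0} = 1)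
    (hpos : Nat.card {i // 0 < hB.eigenvalues i} = Fintype.card ι - 1)
    {o : ι → ℝ} {lam : ℝ} (hlam : lam < 0) (ho : B *ᵥ o = lam • o) (ho0 : o ≠ 0) :
    ∃ c : ℝ, 0 < c ∧ ∀ v, l1 o v = 0 → c * ∑ i, v i ^ 2 ≤ bform B v v := by
  obtain ⟨k, hk, hkpos⟩ : ∃ k, hB.eigenvalues k < 0 ∧ ∀ i, i ≠ k → 0 < hB.eigenvalues i := by
    rw [Nat.card_eq_fintype_card, Fintype.card_subtype] at hneg hpos
    obtain ⟨k, hk⟩ := Finset.card_eq_one.1 hneg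
    have hk' : ∀ i, hB.eigenvalues i < 0 ↔ i = k := fun i => by
      simpa using Finset.ext_iff.1 hk i
    refine ⟨k, (hk' k).2 rfl, fun i hi => ?_⟩
    have hsub : Finset.univ.filter (fun i => 0 < hB.eigenvalues i) ⊆ Finset.univ.erase k := by
      intro j hj
      rw [Finset.mem_filter] at hj
      refine Finset.mem_erase.2 ⟨fun h => ?_, Finset.mem_univ _⟩
      exact absurd ((hk' j).2 h) hj.2.not_gt
    have heq := Finset.eq_of_subset_of_card_le hsub (by
      rw [hpos, Finset.card_erase_of_mem (Finset.mem_univ _), Finset.card_univ])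
    have : i ∈ Finset.univ.filter (fun i => 0 < hB.eigenvalues i) := by
      rw [heq]; simp [hi]
    simpa using this
  set e : ι → ι → ℝ := fun i => (hB.eigenvectorBasis i).ofLp with he
  have hexp : ∀ u v : ι → ℝ, u ⬝ᵥ v = ∑ i, (e i ⬝ᵥ u) * (e i ⬝ᵥ v) := by
    intro u v
    have := hB.eigenvectorBasis.sum_inner_mul_inner (WithLp.toLp 2 u) (WithLp.toLp 2 v)
    simp only [EuclideanSpace.inner_eq_star_dotProduct, star_trivial] at this
    rw [dotProduct_comm, ← this]
    exact Finset.sum_congr rfl fun i _ => by rw [dotProduct_comm v]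
  have heig : ∀ i (v : ι → ℝ), e i ⬝ᵥ B *ᵥ v = hB.eigenvalues i * (e i ⬝ᵥ v) := by
    intro i v
    have h := bform_comm hB (e i) v
    rw [bform, bform, hB.mulVec_eigenvectorBasis, dotProduct_smul, dotProduct_comm v] at h
    exact h
  have horth : ∀ i, i ≠ k → e i ⬝ᵥ o = 0 := by
    intro i hi
    have h := heig i o
    rw [ho, dotProduct_smul, smul_eq_mul] at h
    have h2 : (hB.eigenvalues i - lam) * (e i ⬝ᵥ o) = 0 := by linarith
    exact (mul_eq_zero.1 h2).resolve_left (by linarith [hkpos i hi])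
  have hok : e k ⬝ᵥ o ≠ 0 := by
    intro h
    apply ho0
    rw [← dotProduct_self_eq_zero, hexp]
    refine Finset.sum_eq_zero fun i _ => ?_
    by_cases hi : i = k
    · rw [hi, h, zero_mul]
    · rw [horth i hi, zero_mul]
  obtain ⟨c, hc, hcle⟩ := exists_pos_le_of_forall_pos hkpos
  refine ⟨c, hc, fun v hv => ?_⟩
  have hvk : e k ⬝ᵥ v = 0 := by
    have h : o ⬝ᵥ v = 0 := hv
    rw [hexp, Finset.sum_eq_single k (fun i _ hi => by rw [horth i hi, zero_mul])
      (fun h => absurd (Finset.mem_univ k) h)] at h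
    exact (mul_eq_zero.1 h).resolve_left hok
  have hsq : ∑ i, v i ^ 2 = ∑ i, (e i ⬝ᵥ v) * (e i ⬝ᵥ v) := by
    rw [← hexp]
    exact Finset.sum_congr rfl fun i _ => sq (v i)
  rw [hsq, bform, hexp, Finset.mul_sum]
  refine Finset.sum_le_sum fun i _ => ?_
  rw [heig]
  by_cases hi : i = k
  · rw [hi, hvk]; simp
  · nlinarith [mul_le_mul_of_nonneg_right (hcle i hi) (mul_self_nonneg (e i ⬝ᵥ v))]

/-- A sequence in `{l1 o = 0}` whose `B`-norms tend to zero converges to zero. -/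
lemma tendsto_zero_of_bform_self_le {o : ι → ℝ} {c : ℝ} (hc : 0 < c)
    (hcoer : ∀ v, l1 o v = 0 → c * ∑ i, v i ^ 2 ≤ bform B v v) {d : ℕ → ι → ℝ} {g : ℕ → ℝ}
    (hd : ∀ j, l1 o (d j) = 0) (hle : ∀ j, bform B (d j) (d j) ≤ g j)
    (hg : Tendsto g atTop (nhds 0)) : Tendsto d atTop (nhds 0) := by
  refine tendsto_pi_nhds.2 fun i => ?_
  have hsq : Tendsto (fun j => d j i ^ 2) atTop (nhds 0) := by
    refine squeeze_zero (fun j => sq_nonneg _) (fun j => ?_)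
      (by simpa using hg.const_mul c⁻¹)
    rw [← div_eq_inv_mul, le_div_iff₀' hc]
    refine le_trans ?_ ((hcoer _ (hd j)).trans (hle j))
    gcongr
    exact Finset.single_le_sum (f := fun i => d j i ^ 2) (fun i _ => sq_nonneg _)
      (Finset.mem_univ i)
  have := hsq.sqrt
  simp only [Real.sqrt_sq_eq_abs, Real.sqrt_zero] at this
  exact (tendsto_zero_iff_abs_tendsto_zero _).2 this

end BilinearForm

/-- The sequence `0, 1, 2c, 4c² - 1, …` of values of Chebyshev polynomials of the second kind. -/
def chebSeq (c : ℝ) : ℕ → ℝ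
  | 0 => 0
  | 1 => 1
  | k + 2 => 2 * c * chebSeq c (k + 1) - chebSeq c k

lemma sin_mul_chebSeq_cos (θ : ℝ) (k : ℕ) :
    Real.sin θ * chebSeq (Real.cos θ) k = Real.sin (k * θ) := by
  induction k using Nat.strong_induction_on with
  | _ k ih =>
    match k with
    | 0 => simp [chebSeq]
    | 1 => simp [chebSeq]
    | k + 2 =>
      have h1 := ih (k + 1) (by omega)
      have h0 := ih k (by omega)
      push_cast at h1 ⊢
      rw [chebSeq, mul_sub, h0, mul_left_comm, h1]
      have e2 : ((k : ℝ) + 2) * θ = (k + 1) * θ + θ := by ring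
      have e0 : (k : ℝ) * θ = (k + 1) * θ - θ := by ring
      rw [e2, e0, Real.sin_add, Real.sin_sub]
      ring

lemma chebSeq_cos_nonneg {m k : ℕ} (hm : 2 ≤ m) (hk : k ≤ m) :
    0 ≤ chebSeq (Real.cos (Real.pi / m)) k := by
  have hm0 : (0 : ℝ) < m := by positivity
  have hsin : 0 < Real.sin (Real.pi / m) := by
    refine Real.sin_pos_of_pos_of_lt_pi (by positivity) (div_lt_self Real.pi_pos ?_)
    exact_mod_cast hm
  refine nonneg_of_mul_nonneg_right ?_ hsin
  rw [sin_mul_chebSeq_cos]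
  refine Real.sin_nonneg_of_nonneg_of_le_pi (by positivity) ?_
  rw [mul_div_assoc', div_le_iff₀ hm0, mul_comm]
  gcongr

lemma chebSeq_nonneg_of_one_le {c : ℝ} (hc : 1 ≤ c) (k : ℕ) : 0 ≤ chebSeq c k := by
  suffices 0 ≤ chebSeq c k ∧ chebSeq c k ≤ chebSeq c (k + 1) from this.1
  induction k with
  | zero => simp [chebSeq]
  | succ k ih =>
    refine ⟨ih.1.trans ih.2, ?_⟩
    rw [chebSeq]
    nlinarith [ih.1.trans ih.2]

section Coxeter

variable {n : ℕ} {B : Matrix (Fin n) (Fin n) ℝ} {M : CoxeterMatrix (Fin n)}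
  {W : Type*} [Group W]

/-- If `i` is not a right descent of `w`, then `w` is the length-additive product of an element
without right descents in `{i, j}` and an alternating word in `i`, `j`. -/
lemma exists_mul_alternatingWord (cs : CoxeterSystem M W) (w : W) (i j : Fin n)
    (hi : ¬ cs.IsRightDescent w i) :
    ∃ (k : ℕ) (v : W), w = v * cs.wordProd (CoxeterSystem.alternatingWord i j k) ∧
      cs.length w = cs.length v + k ∧ ¬ cs.IsRightDescent v i ∧ ¬ cs.IsRightDescent v j := by
  induction h : cs.length w generalizing w i j with
  | zero =>
    obtain rfl := cs.length_eq_zero_iff.1 h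
    exact ⟨0, 1, by simp [CoxeterSystem.alternatingWord], by simp,
      cs.not_isRightDescent_one i, cs.not_isRightDescent_one j⟩
  | succ N ih =>
    by_cases hj : cs.IsRightDescent w j
    · have hlen := cs.isRightDescent_iff.1 hj
      obtain ⟨k, v, hw, hl, hvj, hvi⟩ := ih (w * cs.simple j) j i
        (cs.isRightDescent_iff_not_isRightDescent_mul.1 hj) (by omega)
      refine ⟨k + 1, v, ?_, by omega, hvi, hvj⟩
      rw [CoxeterSystem.alternatingWord_succ, cs.wordProd_concat, ← mul_assoc, ← hw,
        mul_assoc, cs.simple_mul_simple_self, mul_one]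
    · exact ⟨0, w, by simp [CoxeterSystem.alternatingWord], by omega, hi, hj⟩

/-- `ρ` is the geometric representation of the Coxeter system attached to `B`. -/
def IsGeometricRep (B : Matrix (Fin n) (Fin n) ℝ) (cs : CoxeterSystem M W)
    (ρ : W →* Module.End ℝ (Fin n → ℝ)) : Prop :=
  ∀ (i : Fin n) (v : Fin n → ℝ),
    ρ (cs.simple i) v = v - (2 * bform B (Pi.single i 1) v) • (Pi.single i 1 : Fin n → ℝ)

variable {cs : CoxeterSystem M W} {ρ : W →* Module.End ℝ (Fin n → ℝ)}

lemma IsGeometricRep.mul_simple_apply (hρ : IsGeometricRep B cs ρ) (w : W) (i : Fin n)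
    (v : Fin n → ℝ) : ρ (w * cs.simple i) v =
      ρ w v - (2 * bform B (Pi.single i 1) v) • ρ w (Pi.single i 1) := by
  rw [map_mul, Module.End.mul_apply, hρ, map_sub, map_smul]

lemma IsGeometricRep.bform_apply (hρ : IsGeometricRep B cs ρ) (hB : B.IsHermitian)
    (hdiag : ∀ i, B i i = 1) (w : W) (u v : Fin n → ℝ) :
    bform B (ρ w u) (ρ w v) = bform B u v := by
  induction w using cs.simple_induction generalizing u v with
  | simple i =>
    simp only [hρ i, bform_sub_left, bform_sub_right, bform_smul_left, bform_smul_right,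
      bform_single_single, hdiag]
    rw [bform_comm hB u (Pi.single i 1)]
    ring
  | one => simp
  | mul w₁ w₂ h₁ h₂ => rw [map_mul, Module.End.mul_apply, Module.End.mul_apply, h₁, h₂]

lemma IsGeometricRep.bform_apply_left (hρ : IsGeometricRep B cs ρ) (hB : B.IsHermitian)
    (hdiag : ∀ i, B i i = 1) (w : W) (u v : Fin n → ℝ) :
    bform B (ρ w u) v = bform B u (ρ w⁻¹ v) := by
  rw [← hρ.bform_apply hB hdiag w u, ← Module.End.mul_apply, ← map_mul, mul_inv_cancel, map_one,
    Module.End.one_apply]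

lemma IsGeometricRep.alternatingWord_apply_single (hρ : IsGeometricRep B cs ρ)
    (hB : B.IsHermitian) (hdiag : ∀ i, B i i = 1) (i j : Fin n) (k : ℕ) :
    ρ (cs.wordProd (CoxeterSystem.alternatingWord i j k)) (Pi.single i 1) =
      chebSeq (-B i j) (k + 1) • (Pi.single (if Even k then i else j) 1 : Fin n → ℝ) +
        chebSeq (-B i j) k • (Pi.single (if Even k then j else i) 1 : Fin n → ℝ) := by
  have hji : B j i = B i j := by simpa using hB.apply i j
  induction k with
  | zero => simp [CoxeterSystem.alternatingWord, chebSeq]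
  | succ k ih =>
    rw [CoxeterSystem.alternatingWord_succ', cs.wordProd_cons, map_mul, Module.End.mul_apply, ih,
      hρ, bform_add_right, bform_smul_right, bform_smul_right]
    by_cases hk : Even k
    · simp only [hk, Nat.even_add_one, not_true_eq_false, if_true, if_false,
        bform_single_single, hdiag, hji, chebSeq]
      module
    · simp only [hk, Nat.even_add_one, not_false_eq_true, if_true, if_false,
        bform_single_single, hdiag, chebSeq]
      module

/-- The compatibility between `B` and the Coxeter matrix `M`. -/
structure IsCompatible (B : Matrix (Fin n) (Fin n) ℝ) (M : CoxeterMatrix (Fin n)) : Prop where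
  isHermitian : B.IsHermitian
  diag : ∀ i, B i i = 1
  finite : ∀ i j, M i j ≠ 0 → B i j = -Real.cos (Real.pi / (M i j : ℝ))
  infinite : ∀ i j, M i j = 0 → B i j ≤ -1

lemma two_le_coxeterMatrix_apply (M : CoxeterMatrix (Fin n)) {i j : Fin n} (hij : i ≠ j)
    (h0 : M i j ≠ 0) : 2 ≤ M i j := by
  have := M.off_diagonal i j hij
  omega

lemma IsCompatible.nonpos (h : IsCompatible B M) {i j : Fin n} (hij : i ≠ j) : B i j ≤ 0 := by
  by_cases h0 : M i j = 0
  · linarith [h.infinite i j h0]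
  · rw [h.finite i j h0, neg_nonpos]
    have h2 : (2 : ℝ) ≤ M i j := by exact_mod_cast two_le_coxeterMatrix_apply M hij h0
    refine Real.cos_nonneg_of_neg_pi_div_two_le_of_le ?_ ?_
    · exact le_trans (by linarith [Real.pi_pos]) (show (0 : ℝ) ≤ _ by positivity)
    · gcongr

/-- If `i` is not a right descent of `w`, then `w αᵢ` is a positive root. -/
theorem IsGeometricRep.apply_single_nonneg (hρ : IsGeometricRep B cs ρ) (h : IsCompatible B M)
    (w : W) (i : Fin n) (hi : ¬ cs.IsRightDescent w i) : 0 ≤ ρ w (Pi.single i 1) := by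
  induction hN : cs.length w using Nat.strong_induction_on generalizing w i with
  | _ N ih =>
    subst hN
    by_cases hw1 : w = 1
    · rw [hw1, map_one, Module.End.one_apply]
      exact Pi.single_nonneg.2 zero_le_one
    obtain ⟨j, hj⟩ := cs.exists_rightDescent_of_ne_one hw1
    have hij : i ≠ j := fun hij => hi (hij ▸ hj)
    obtain ⟨k, v, hw, hl, hvi, hvj⟩ := exists_mul_alternatingWord cs w i j hi
    have hk : k ≠ 0 := by
      rintro rfl
      rw [show w = v by simpa [CoxeterSystem.alternatingWord] using hw] at hj
      exact hvj hj
    have hv : ∀ l, l = i ∨ l = j → 0 ≤ ρ v (Pi.single l 1) := by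
      rintro l (rfl | rfl)
      · exact ih _ (by omega) v _ hvi rfl
      · exact ih _ (by omega) v _ hvj rfl
    have hcoef : ∀ l, l ≤ k + 1 → 0 ≤ chebSeq (-B i j) l := by
      intro l hlk
      by_cases h0 : M i j = 0
      · exact chebSeq_nonneg_of_one_le (by linarith [h.infinite i j h0]) l
      · rw [h.finite i j h0, neg_neg]
        refine chebSeq_cos_nonneg (two_le_coxeterMatrix_apply M hij h0) (hlk.trans ?_)
        by_contra! hlt
        have hlt' : k + 1 > M j i := by rwa [M.symmetric j i]
        refine cs.not_isReduced_alternatingWord j i (by rwa [M.symmetric j i]) hlt' ?_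
        have h1 := cs.not_isRightDescent_iff.1 hi
        have h2 : w * cs.simple i =
            v * cs.wordProd (CoxeterSystem.alternatingWord j i (k + 1)) := by
          rw [CoxeterSystem.alternatingWord_succ, cs.wordProd_concat, ← mul_assoc, ← hw]
        have h3 := cs.length_mul_le v (cs.wordProd (CoxeterSystem.alternatingWord j i (k + 1)))
        have h4 := cs.length_wordProd_le (CoxeterSystem.alternatingWord j i (k + 1))
        rw [← h2] at h3
        rw [CoxeterSystem.IsReduced]
        rw [CoxeterSystem.length_alternatingWord] at h4 ⊢
        omega
    rw [hw, map_mul, Module.End.mul_apply,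
      hρ.alternatingWord_apply_single h.isHermitian h.diag, map_add, map_smul, map_smul]
    refine add_nonneg (smul_nonneg (hcoef _ le_rfl) (hv _ ?_))
      (smul_nonneg (hcoef _ (by omega)) (hv _ ?_)) <;> split_ifs <;> simp

/-- Points of the closed chamber are coordinatewise minimal in their orbit. -/
lemma IsGeometricRep.le_apply (hρ : IsGeometricRep B cs ρ) (h : IsCompatible B M)
    {p : Fin n → ℝ} (hp : ∀ i, bform B (Pi.single i 1) p ≤ 0) (w : W) : p ≤ ρ w p := by
  induction hN : cs.length w generalizing w with
  | zero => simp [cs.length_eq_zero_iff.1 hN]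
  | succ N ih =>
    obtain ⟨i, hi⟩ := cs.exists_rightDescent_of_ne_one (w := w) (by rintro rfl; simp at hN)
    have hlen := cs.isRightDescent_iff.1 hi
    have hpos := hρ.apply_single_nonneg h _ i (cs.isRightDescent_iff_not_isRightDescent_mul.1 hi)
    have e := hρ.mul_simple_apply (w * cs.simple i) i p
    rw [cs.simple_mul_simple_cancel_right] at e
    rw [e]
    refine (ih (w * cs.simple i) (by omega)).trans ?_
    rw [le_sub_self_iff]
    exact smul_nonpos_of_nonpos_of_nonneg (by linarith [hp i]) hpos

lemma exists_pos_le_l1_of_bform_self_eq_one (h : IsCompatible B M) {o : Fin n → ℝ}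
    (ho : ∀ i, 0 < o i) :
    ∃ c : ℝ, 0 < c ∧ ∀ v, 0 ≤ v → bform B v v = 1 → c ≤ l1 o v := by
  set C := ∑ i, 1 / o i ^ 2 with hC
  have hC0 : 0 ≤ C := Finset.sum_nonneg fun i _ => by have := ho i; positivity
  refine ⟨1 / (1 + C), by positivity, fun v hv h1 => ?_⟩
  have hl : 0 ≤ l1 o v := l1_nonneg ho hv
  have hle : bform B v v ≤ ∑ i, v i ^ 2 := by
    rw [bform, dotProduct]
    refine Finset.sum_le_sum fun i _ => ?_
    rw [sq]
    refine mul_le_mul_of_nonneg_left ?_ (hv i)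
    rw [mulVec, dotProduct, Finset.sum_eq_add_sum_sdiff_singleton_of_mem (Finset.mem_univ i),
      h.diag, one_mul]
    refine add_le_of_nonpos_right (Finset.sum_nonpos fun j hj => ?_)
    refine mul_nonpos_of_nonpos_of_nonneg (h.nonpos ?_) (hv j)
    rintro rfl
    simp at hj
  have hsq : ∑ i, v i ^ 2 ≤ C * l1 o v ^ 2 := by
    rw [hC, Finset.sum_mul]
    refine Finset.sum_le_sum fun i _ => ?_
    have hoi := ho i
    have hi : o i * v i ≤ l1 o v :=
      Finset.single_le_sum (f := fun i => o i * v i) (fun i _ => mul_nonneg (ho i).le (hv i))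
        (Finset.mem_univ i)
    have := pow_le_pow_left₀ (mul_nonneg hoi.le (hv i)) hi 2
    rw [one_div, ← div_eq_inv_mul, le_div_iff₀ (by positivity)]
    linarith [mul_pow (o i) (v i) 2]
  rw [div_le_iff₀ (by positivity)]
  by_contra! hlt
  have hx : l1 o v < 1 := by nlinarith
  nlinarith

/-- The orbit of `o` leaves every bounded set. -/
lemma IsGeometricRep.tendsto_l1_apply (hρ : IsGeometricRep B cs ρ) (h : IsCompatible B M)
    {o : Fin n → ℝ} {lam : ℝ} (hlam : lam < 0) (ho : B *ᵥ o = lam • o) (hopos : ∀ i, 0 < o i) :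
    Tendsto (fun w => l1 o (ρ w o)) cofinite atTop := by
  obtain ⟨c, hc, hcl⟩ := exists_pos_le_l1_of_bform_self_eq_one h hopos
  obtain ⟨d, hd, hdl⟩ := exists_pos_le_of_forall_pos (p := fun _ => True) fun i _ => hopos i
  have hB : ∀ i, bform B (Pi.single i 1) o = lam * o i := fun i => by
    rw [bform_single_left, ho]; rfl
  have key : ∀ w, -2 * lam * d * c * cs.length w ≤ l1 o (ρ w o) := by
    intro w
    induction hN : cs.length w generalizing w with
    | zero =>
      rw [cs.length_eq_zero_iff.1 hN, map_one, Module.End.one_apply]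
      simpa using l1_nonneg hopos fun i => (hopos i).le
    | succ N ih =>
      obtain ⟨i, hi⟩ := cs.exists_rightDescent_of_ne_one (w := w) (by rintro rfl; simp at hN)
      have hlen := cs.isRightDescent_iff.1 hi
      have hpos := hρ.apply_single_nonneg h _ i
        (cs.isRightDescent_iff_not_isRightDescent_mul.1 hi)
      have e := hρ.mul_simple_apply (w * cs.simple i) i o
      rw [cs.simple_mul_simple_cancel_right] at e
      have hroot := hcl _ hpos (by
        rw [hρ.bform_apply h.isHermitian h.diag, bform_single_single, h.diag])
      rw [e, l1_sub, l1_smul, hB]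
      have h1 := ih (w * cs.simple i) (by omega)
      have h2 : d * c ≤ o i * l1 o (ρ (w * cs.simple i) (Pi.single i 1)) :=
        mul_le_mul (hdl i trivial) hroot hc.le (hopos i).le
      have h3 := mul_le_mul_of_nonneg_left h2 (show 0 ≤ -2 * lam by linarith)
      push_cast
      nlinarith
  refine tendsto_atTop.2 fun R => ?_
  have hpos : 0 < -2 * lam * d * c := mul_pos (mul_pos (by linarith) hd) hc
  have hfin : {w : W | cs.length w ≤ ⌈R / (-2 * lam * d * c)⌉₊}.Finite := by
    refine ((List.finite_length_le (Fin n) ⌈R / (-2 * lam * d * c)⌉₊).image cs.wordProd).subset ?_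
    intro w hw
    obtain ⟨ω, hω, rfl⟩ := cs.exists_isReduced w
    exact ⟨ω, by simpa [← hω.eq] using hw, rfl⟩
  filter_upwards [hfin.compl_mem_cofinite] with w hw
  refine le_trans ?_ (key w)
  rw [← div_le_iff₀' hpos]
  have hw' : ⌈R / (-2 * lam * d * c)⌉₊ < cs.length w := not_le.1 hw
  exact (Nat.le_ceil _).trans (by exact_mod_cast hw'.le)

end Coxeter

/-- `B` is a Lorentzian form with normalized positive timelike eigenvector `o`. -/
structure IsLorentzian {ι : Type*} [Fintype ι] (B : Matrix ι ι ℝ) (o : ι → ℝ) (lam : ℝ) :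
    Prop where
  isHermitian : B.IsHermitian
  neg : lam < 0
  eigen : B *ᵥ o = lam • o
  pos : ∀ i, 0 < o i
  l1_self : l1 o o = 1
  coercive : ∃ c : ℝ, 0 < c ∧ ∀ v, l1 o v = 0 → c * ∑ i, v i ^ 2 ≤ bform B v v

namespace IsLorentzian

variable {ι : Type*} [Fintype ι] {B : Matrix ι ι ℝ} {o : ι → ℝ} {lam : ℝ}

lemma of_signature [DecidableEq ι] (hB : B.IsHermitian)
    (hneg : Nat.card {i // hB.eigenvalues i < 0} = 1)
    (hpos : Nat.card {i // 0 < hB.eigenvalues i} = Fintype.card ι - 1)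
    (hlam : lam < 0) (ho : B *ᵥ o = lam • o) (hopos : ∀ i, 0 < o i)
    (honorm : ∑ i, o i ^ 2 = 1) : IsLorentzian B o lam where
  isHermitian := hB
  neg := hlam
  eigen := ho
  pos := hopos
  l1_self := by simpa [l1, sq] using honorm
  coercive := exists_coercive_const hB hneg hpos hlam ho (by rintro rfl; simp at honorm)

lemma bform_right (h : IsLorentzian B o lam) (v : ι → ℝ) : bform B v o = lam * l1 o v :=
  bform_right_of_eigenvector h.eigen v

lemma bform_left (h : IsLorentzian B o lam) (v : ι → ℝ) : bform B o v = lam * l1 o v := by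
  rw [bform_comm h.isHermitian, h.bform_right]

lemma bform_self_neg (h : IsLorentzian B o lam) : bform B o o < 0 := by
  rw [h.bform_right, h.l1_self, mul_one]
  exact h.neg

lemma reverse_cauchy_schwarz (h : IsLorentzian B o lam) {u z : ι → ℝ}
    (hu : bform B u u ≤ 0) (hu1 : 0 < l1 o u) (hz1 : 0 < l1 o z) :
    l1 o u * (-bform B z z / (2 * l1 o z)) ≤ -bform B u z := by
  obtain ⟨c, hc, hcoer⟩ := h.coercive
  refine _root_.reverse_cauchy_schwarz h.isHermitian (fun v hv => ?_) hu hu1 hz1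
  exact le_trans (mul_nonneg hc.le (Finset.sum_nonneg fun i _ => sq_nonneg _)) (hcoer v hv)

lemma bform_neg (h : IsLorentzian B o lam) {u z : ι → ℝ} (hu : bform B u u ≤ 0)
    (hu1 : 0 < l1 o u) (hz : bform B z z < 0) (hz1 : 0 < l1 o z) : bform B u z < 0 := by
  have h1 := h.reverse_cauchy_schwarz hu hu1 hz1
  have h2 : 0 < l1 o u * (-bform B z z / (2 * l1 o z)) :=
    mul_pos hu1 (div_pos (by linarith) (by linarith))
  linarith

/-- If the `B`-products of two normalized causal sequences tend to zero, so does their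
difference. -/
lemma tendsto_sub_zero (h : IsLorentzian B o lam) {a b : ℕ → ι → ℝ} {g : ℕ → ℝ}
    (ha1 : ∀ j, l1 o (a j) = 1) (hb1 : ∀ j, l1 o (b j) = 1)
    (ha : ∀ j, bform B (a j) (a j) ≤ 0) (hb : ∀ j, bform B (b j) (b j) ≤ 0)
    (hle : ∀ j, -bform B (a j) (b j) ≤ g j) (hg : Tendsto g atTop (nhds 0)) :
    Tendsto (fun j => a j - b j) atTop (nhds 0) := by
  obtain ⟨c, hc, hcoer⟩ := h.coercive
  refine tendsto_zero_of_bform_self_le hc hcoer (g := fun j => 2 * g j) (fun j => ?_)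
    (fun j => ?_) (by simpa using hg.const_mul 2)
  · rw [l1_sub, ha1, hb1, sub_self]
  · rw [bform_self_sub h.isHermitian]
    linarith [ha j, hb j, hle j]

/-- Normalized causal vectors in the closed chamber belong to the closure of the open chamber. -/
lemma nrm_mem_closure_chamber [DecidableEq ι] (h : IsLorentzian B o lam) {u : ι → ℝ}
    (hu : bform B u u < 0) (hu1 : 0 < l1 o u) (hch : ∀ i, bform B (Pi.single i 1) u ≤ 0) :
    nrm o u ∈ closure {v : ι → ℝ | l1 o v = 1 ∧ bform B v v < 0 ∧
      ∀ i, bform B (Pi.single i 1) v < 0} := by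
  have hlim : Tendsto (fun t : ℝ => nrm o (u + t • o)) (nhdsWithin 0 (Ioi 0))
      (nhds (nrm o u)) := by
    have hc : ContinuousAt (fun t : ℝ => nrm o (u + t • o)) 0 := by
      refine ContinuousAt.comp (continuousAt_nrm (by simpa using hu1.ne')) ?_
      fun_prop
    simpa using hc.tendsto.mono_left nhdsWithin_le_nhds
  refine mem_closure_of_tendsto hlim ?_
  filter_upwards [self_mem_nhdsWithin] with t ht
  have ht : 0 < t := ht
  have hl : l1 o (u + t • o) = l1 o u + t := by rw [l1_add, l1_smul, h.l1_self, mul_one]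
  have hl0 : 0 < l1 o (u + t • o) := by rw [hl]; positivity
  refine ⟨l1_nrm hl0.ne', ?_, fun i => ?_⟩
  · rw [bform_nrm]
    refine div_neg_of_neg_of_pos ?_ (by positivity)
    rw [bform_add_left, bform_add_right, bform_add_right, bform_smul_left, bform_smul_left,
      bform_smul_right, bform_smul_right, h.bform_right, h.bform_left, h.bform_right, h.l1_self]
    have := h.neg
    have h1 : lam * l1 o u < 0 := mul_neg_of_neg_of_pos this hu1
    have h2 : t * (lam * l1 o u) < 0 := mul_neg_of_pos_of_neg ht h1
    have h3 : t * (t * (lam * 1)) < 0 :=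
      mul_neg_of_pos_of_neg ht (mul_neg_of_pos_of_neg ht (by linarith))
    linarith
  · rw [nrm, bform_smul_right, bform_add_right, bform_smul_right, h.bform_right, l1_single]
    refine mul_neg_of_pos_of_neg (inv_pos.2 hl0) ?_
    have := mul_neg_of_pos_of_neg ht (mul_neg_of_neg_of_pos h.neg (h.pos i))
    linarith [hch i]

/-- For a cocompact chamber, the form is uniformly negative on the normalized closed chamber. -/
lemma exists_bform_self_le_of_cocompact [DecidableEq ι] (h : IsLorentzian B o lam)
    (hcpt : IsCompact (closure {v : ι → ℝ | l1 o v = 1 ∧ bform B v v < 0 ∧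
      ∀ i, bform B (Pi.single i 1) v < 0}))
    (hsub : closure {v : ι → ℝ | l1 o v = 1 ∧ bform B v v < 0 ∧
      ∀ i, bform B (Pi.single i 1) v < 0} ⊆ {v : ι → ℝ | l1 o v = 1 ∧ bform B v v < 0}) :
    ∃ δ : ℝ, 0 < δ ∧ ∀ u, bform B u u < 0 → 0 < l1 o u →
      (∀ i, bform B (Pi.single i 1) u ≤ 0) → δ * l1 o u ^ 2 ≤ -bform B u u := by
  have hne : (closure {v : ι → ℝ | l1 o v = 1 ∧ bform B v v < 0 ∧
      ∀ i, bform B (Pi.single i 1) v < 0}).Nonempty :=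
    ⟨_, h.nrm_mem_closure_chamber h.bform_self_neg (by simp [h.l1_self]) fun i => by
      rw [h.bform_right, l1_single]
      exact (mul_neg_of_neg_of_pos h.neg (h.pos i)).le⟩
  obtain ⟨m, hm, hmax⟩ := hcpt.exists_isMaxOn hne (continuous_bform_self (B := B)).continuousOn
  refine ⟨-bform B m m, by linarith [(hsub hm).2], fun u hu hu1 hch => ?_⟩
  have := hmax (h.nrm_mem_closure_chamber hu hu1 hch)
  simp only [mem_ofPred_eq, bform_nrm] at this
  rw [div_le_iff₀ (by positivity)] at this
  linarith

end IsLorentzian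

section SpecialSubgroup

variable {n : ℕ} {Δ' : Finset (Fin n)}

lemma ext0_of_mem (v : {i // i ∈ Δ'} → ℝ) {i : Fin n} (hi : i ∈ Δ') : ext0 Δ' v i = v ⟨i, hi⟩ :=
  dif_pos hi

lemma ext0_of_notMem (v : {i // i ∈ Δ'} → ℝ) {i : Fin n} (hi : i ∉ Δ') : ext0 Δ' v i = 0 :=
  dif_neg hi

lemma ext0_coe (v : {i // i ∈ Δ'} → ℝ) (i : {i // i ∈ Δ'}) : ext0 Δ' v i = v i :=
  ext0_of_mem v i.2

lemma ext0_injective : Function.Injective (ext0 Δ') := fun u v h =>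
  funext fun i => by rw [← ext0_coe u, ← ext0_coe v, h]

lemma ext0_smul (a : ℝ) (v : {i // i ∈ Δ'} → ℝ) : ext0 Δ' (a • v) = a • ext0 Δ' v := by
  ext i
  by_cases hi : i ∈ Δ' <;> simp [ext0, hi]

lemma nrm_ext0_nrm (o : Fin n → ℝ) {o' v : {i // i ∈ Δ'} → ℝ} (h : l1 o' v ≠ 0) :
    nrm o (ext0 Δ' (nrm o' v)) = nrm o (ext0 Δ' v) := by
  rw [nrm.eq_1 o' v, ext0_smul, nrm_smul o (inv_ne_zero h)]

lemma ext0_nonneg {v : {i // i ∈ Δ'} → ℝ} (hv : 0 ≤ v) : 0 ≤ ext0 Δ' v := by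
  intro i
  by_cases hi : i ∈ Δ'
  · rw [ext0_of_mem v hi]
    exact hv _
  · rw [ext0_of_notMem v hi]
    rfl

lemma ext0_restrict {y : Fin n → ℝ} (hy : ∀ i, i ∉ Δ' → y i = 0) :
    ext0 Δ' (fun i => y i) = y := by
  ext i
  by_cases hi : i ∈ Δ'
  · rw [ext0_of_mem _ hi]
  · rw [ext0_of_notMem _ hi, hy i hi]

lemma continuous_ext0 : Continuous (ext0 Δ') := by
  refine continuous_pi fun i => ?_
  by_cases hi : i ∈ Δ'
  · simpa only [ext0_of_mem _ hi] using continuous_apply _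
  · simpa only [ext0_of_notMem _ hi] using continuous_const

lemma ext0_single (i : {i // i ∈ Δ'}) : ext0 Δ' (Pi.single i 1) = Pi.single i.1 1 := by
  ext j
  by_cases hj : j ∈ Δ'
  · simp [ext0_of_mem _ hj, Pi.single_apply, Subtype.ext_iff]
  · rw [ext0_of_notMem _ hj, Pi.single_eq_of_ne]
    rintro rfl
    exact hj i.2

lemma sum_mul_ext0 (a : Fin n → ℝ) (v : {i // i ∈ Δ'} → ℝ) :
    ∑ i, a i * ext0 Δ' v i = ∑ i : {i // i ∈ Δ'}, a i * v i := by
  rw [← Finset.sum_subset (Finset.subset_univ Δ')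
    (fun i _ hi => by rw [ext0_of_notMem v hi, mul_zero]), ← Finset.sum_coe_sort Δ']
  exact Finset.sum_congr rfl fun i _ => by rw [ext0_coe]

lemma bform_submatrix (B : Matrix (Fin n) (Fin n) ℝ) (u v : {i // i ∈ Δ'} → ℝ) :
    bform (B.submatrix (Subtype.val : {i // i ∈ Δ'} → Fin n) Subtype.val) u v =
      bform B (ext0 Δ' u) (ext0 Δ' v) := by
  have h : ∀ i, (B *ᵥ ext0 Δ' v) i = ∑ j : {i // i ∈ Δ'}, B i j * v j := fun i =>
    sum_mul_ext0 (B i) v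
  rw [bform, bform, dotProduct_comm (ext0 Δ' u)]
  refine Eq.trans ?_ (sum_mul_ext0 (B *ᵥ ext0 Δ' v) u).symm
  exact Finset.sum_congr rfl fun i _ => by rw [h, mul_comm]; rfl

variable {B : Matrix (Fin n) (Fin n) ℝ} {M : CoxeterMatrix (Fin n)} {W : Type*} [Group W]
  {cs : CoxeterSystem M W} {ρ : W →* Module.End ℝ (Fin n → ℝ)} {o : Fin n → ℝ} {lam : ℝ}
  {o' : {i // i ∈ Δ'} → ℝ} {lam' : ℝ}

/-- The special subgroup preserves the span of its simple roots. -/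
lemma IsGeometricRep.apply_eq_zero_of_notMem (hρ : IsGeometricRep B cs ρ) {w : W}
    (hw : w ∈ Subgroup.closure (cs.simple '' (Δ' : Set (Fin n)))) {y : Fin n → ℝ}
    (hy : ∀ i, i ∉ Δ' → y i = 0) : ∀ i, i ∉ Δ' → ρ w y i = 0 := by
  have hsimple : ∀ k ∈ Δ', ∀ y : Fin n → ℝ, (∀ i, i ∉ Δ' → y i = 0) →
      ∀ i, i ∉ Δ' → ρ (cs.simple k) y i = 0 := by
    intro k hk y hy i hi
    have hik : i ≠ k := by rintro rfl; exact hi hk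
    rw [hρ]
    simp [hy i hi, hik]
  induction hw using Subgroup.closure_induction'' generalizing y with
  | mem x hx =>
    obtain ⟨k, hk, rfl⟩ := hx
    exact hsimple k hk y hy
  | inv_mem x hx =>
    obtain ⟨k, hk, rfl⟩ := hx
    rw [cs.inv_simple]
    exact hsimple k hk y hy
  | one => simpa using hy
  | mul a b _ _ ha hb =>
    rw [map_mul, Module.End.mul_apply]
    exact ha (hb hy)

lemma IsGeometricRep.ext0_apply (hρ : IsGeometricRep B cs ρ) {w : W}
    (hw : w ∈ Subgroup.closure (cs.simple '' (Δ' : Set (Fin n)))) (v : {i // i ∈ Δ'} → ℝ) :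
    ext0 Δ' (fun i => ρ w (ext0 Δ' v) i) = ρ w (ext0 Δ' v) :=
  ext0_restrict (hρ.apply_eq_zero_of_notMem hw fun _ hi => ext0_of_notMem v hi)

/-- The orbit of any forward timelike vector leaves every bounded set. -/
lemma IsGeometricRep.tendsto_l1_apply_of_timelike (hρ : IsGeometricRep B cs ρ)
    (h : IsCompatible B M) (hL : IsLorentzian B o lam) {z : Fin n → ℝ} (hz : bform B z z < 0)
    (hz1 : 0 < l1 o z) : Tendsto (fun w => l1 o (ρ w z)) cofinite atTop := by
  have ht := (hρ.tendsto_l1_apply h hL.neg hL.eigen hL.pos).comp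
    (inv_injective (G := W)).tendsto_cofinite
  have hlam := hL.neg
  set c := -bform B z z / (2 * l1 o z) with hc
  have hc0 : 0 < c := div_pos (by linarith) (by linarith)
  have hk : 0 < c / -lam := div_pos hc0 (by linarith)
  refine tendsto_atTop_mono (fun w => ?_) (ht.const_mul_atTop hk)
  have hle := hρ.le_apply h (p := o) (fun i => by
    rw [hL.bform_right, l1_single]
    exact (mul_neg_of_neg_of_pos hlam (hL.pos i)).le) w⁻¹
  have h1 : 0 < l1 o (ρ w⁻¹ o) := by
    linarith [l1_mono hL.pos hle, hL.l1_self]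
  have h2 := hL.reverse_cauchy_schwarz (u := ρ w⁻¹ o)
    (by rw [hρ.bform_apply h.isHermitian h.diag]; exact hL.bform_self_neg.le) h1 hz1
  rw [hρ.bform_apply_left h.isHermitian h.diag, inv_inv, hL.bform_left] at h2
  rw [Function.comp_apply, div_mul_eq_mul_div, div_le_iff₀ (by linarith)]
  linarith

/-- Every forward timelike vector can be moved into the closed chamber of the special subgroup. -/
lemma IsGeometricRep.exists_mem_chamber (hρ : IsGeometricRep B cs ρ)
    (h : IsCompatible B M) (hL : IsLorentzian B o lam) {z : Fin n → ℝ} (hz : bform B z z < 0)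
    (hz1 : 0 < l1 o z) : ∃ w ∈ Subgroup.closure (cs.simple '' (Δ' : Set (Fin n))),
      ∀ i ∈ Δ', bform B (Pi.single i 1) (ρ w z) ≤ 0 := by
  obtain ⟨w, hw⟩ := Tendsto.exists_forall_le ((hρ.tendsto_l1_apply_of_timelike h hL hz hz1).comp
    (Subtype.val_injective (p := (· ∈ Subgroup.closure
      (cs.simple '' (Δ' : Set (Fin n)))))).tendsto_cofinite)
  refine ⟨w.1, w.2, fun i hi => ?_⟩
  have hmem : cs.simple i * w.1 ∈ Subgroup.closure (cs.simple '' (Δ' : Set (Fin n))) :=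
    mul_mem (Subgroup.subset_closure ⟨i, hi, rfl⟩) w.2
  have hle : l1 o (ρ w.1 z) ≤ l1 o (ρ (cs.simple i * w.1) z) := hw ⟨_, hmem⟩
  rw [map_mul, Module.End.mul_apply, hρ, l1_sub, l1_smul, l1_single] at hle
  have := hL.pos i
  by_contra! hlt
  have := mul_pos hlt this
  linarith

/-- The distinguished vector of a special subgroup lies in the closed chamber of the group. -/
lemma bform_single_ext0_nonpos (h : IsCompatible B M)
    (hL' : IsLorentzian (B.submatrix (Subtype.val : {i // i ∈ Δ'} → Fin n) Subtype.val) o' lam')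
    (i : Fin n) : bform B (Pi.single i 1) (ext0 Δ' o') ≤ 0 := by
  by_cases hi : i ∈ Δ'
  · rw [← ext0_single ⟨i, hi⟩, ← bform_submatrix, hL'.bform_right, l1_single]
    exact (mul_neg_of_neg_of_pos hL'.neg (hL'.pos _)).le
  · rw [bform_single_left]
    refine (sum_mul_ext0 (B i) o').trans_le (Finset.sum_nonpos fun j _ => ?_)
    refine mul_nonpos_of_nonpos_of_nonneg (h.nonpos ?_) (hL'.pos j).le
    rintro rfl
    exact hi j.2

lemma one_le_l1_restrict_apply (hρ : IsGeometricRep B cs ρ) (h : IsCompatible B M)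
    (hL' : IsLorentzian (B.submatrix (Subtype.val : {i // i ∈ Δ'} → Fin n) Subtype.val) o' lam')
    (w : W) : 1 ≤ l1 o' (fun i : {i // i ∈ Δ'} => ρ w (ext0 Δ' o') i) := by
  rw [← hL'.l1_self]
  refine l1_mono hL'.pos fun i => ?_
  rw [← ext0_coe o' i]
  exact hρ.le_apply h (bform_single_ext0_nonpos h hL') w i

/-- For a cocompact special subgroup, every nonnegative normalized isotropic vector is a limit
point. -/
theorem exists_tendsto_of_isotropic (hρ : IsGeometricRep B cs ρ) (h : IsCompatible B M)
    (hL : IsLorentzian B o lam)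
    (hL' : IsLorentzian (B.submatrix (Subtype.val : {i // i ∈ Δ'} → Fin n) Subtype.val) o' lam')
    {δ : ℝ} (hδ : 0 < δ)
    (hcpt : ∀ u, bform (B.submatrix (Subtype.val : {i // i ∈ Δ'} → Fin n) Subtype.val) u u < 0 →
      0 < l1 o' u →
      (∀ i, bform (B.submatrix (Subtype.val : {i // i ∈ Δ'} → Fin n) Subtype.val)
        (Pi.single i 1) u ≤ 0) →
      δ * l1 o' u ^ 2 ≤
        -bform (B.submatrix (Subtype.val : {i // i ∈ Δ'} → Fin n) Subtype.val) u u)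
    {x : {i // i ∈ Δ'} → ℝ} (hx : 0 ≤ x) (hx1 : l1 o' x = 1)
    (hx0 : bform (B.submatrix (Subtype.val : {i // i ∈ Δ'} → Fin n) Subtype.val) x x = 0) :
    ∃ f : ℕ → W, (∀ j, f j ∈ Subgroup.closure (cs.simple '' (Δ' : Set (Fin n)))) ∧
      Function.Injective f ∧
      Tendsto (fun j => nrm o' (fun i : {i // i ∈ Δ'} => ρ (f j) (ext0 Δ' o') i))
        atTop (nhds x) := by
  set B' := B.submatrix (Subtype.val : {i // i ∈ Δ'} → Fin n) Subtype.val with hB'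
  have hsub : ∀ u v, bform B' u v = bform B (ext0 Δ' u) (ext0 Δ' v) := bform_submatrix B
  have hlam := hL'.neg
  set t : ℕ → ℝ := fun j => 1 / ((j : ℝ) + 1) with ht
  have ht0 : ∀ j, 0 < t j := fun j => by positivity
  have ht1 : ∀ j, t j ≤ 1 := fun j => by
    rw [ht, div_le_one (by positivity)]
    linarith [(Nat.cast_nonneg j : (0 : ℝ) ≤ j)]
  have htlim : Tendsto t atTop (nhds 0) := tendsto_one_div_add_atTop_nhds_zero_nat
  set z : ℕ → {i // i ∈ Δ'} → ℝ := fun j => (1 - t j) • x + t j • o' with hz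
  have hz1 : ∀ j, l1 o' (z j) = 1 := fun j => by
    rw [hz, l1_add, l1_smul, l1_smul, hx1, hL'.l1_self]
    ring
  have hzB : ∀ j, bform B' (z j) (z j) = lam' * (t j * (2 - t j)) := fun j => by
    simp only [hz]
    rw [bform_add_left, bform_add_right, bform_add_right, bform_smul_left, bform_smul_left,
      bform_smul_left, bform_smul_left, bform_smul_right, bform_smul_right, bform_smul_right,
      bform_smul_right, hL'.bform_right, hL'.bform_left, hL'.bform_right, hL'.l1_self, hx1, hx0]
    ring
  have hzneg : ∀ j, bform B' (z j) (z j) < 0 := fun j => by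
    rw [hzB]
    exact mul_neg_of_neg_of_pos hlam (mul_pos (ht0 j) (by linarith [ht1 j]))
  have hz0 : ∀ j, 0 ≤ z j := fun j =>
    add_nonneg (smul_nonneg (by linarith [ht1 j]) hx)
      (smul_nonneg (ht0 j).le fun i => (hL'.pos i).le)
  have hzlim : Tendsto z atTop (nhds x) := by
    have : Tendsto z atTop (nhds ((1 - (0 : ℝ)) • x + (0 : ℝ) • o')) :=
      ((tendsto_const_nhds.sub htlim).smul_const x).add (htlim.smul_const o')
    simpa using this
  have hchamber : ∀ j, ∃ w ∈ Subgroup.closure (cs.simple '' (Δ' : Set (Fin n))),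
      ∀ i ∈ Δ', bform B (Pi.single i 1) (ρ w (ext0 Δ' (z j))) ≤ 0 := fun j => by
    refine hρ.exists_mem_chamber h hL (by rw [← hsub]; exact hzneg j)
      (l1_pos hL.pos (ext0_nonneg (hz0 j)) fun h0 => ?_)
    have := hzneg j
    rw [hsub, h0] at this
    simp [bform] at this
  choose w hw hwch using hchamber
  set u : ℕ → {i // i ∈ Δ'} → ℝ := fun j i => ρ (w j) (ext0 Δ' (z j)) i with hu
  set q : ℕ → {i // i ∈ Δ'} → ℝ := fun j i => ρ (w j)⁻¹ (ext0 Δ' o') i with hq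
  have hu_ext : ∀ j, ext0 Δ' (u j) = ρ (w j) (ext0 Δ' (z j)) := fun j => hρ.ext0_apply (hw j) _
  have hq_ext : ∀ j, ext0 Δ' (q j) = ρ (w j)⁻¹ (ext0 Δ' o') := fun j =>
    hρ.ext0_apply (inv_mem (hw j)) _
  have hq1 : ∀ j, 1 ≤ l1 o' (q j) := fun j => one_le_l1_restrict_apply hρ h hL' _
  have hqB : ∀ j, bform B' (q j) (q j) = lam' := fun j => by
    rw [hsub, hq_ext, hρ.bform_apply h.isHermitian h.diag, ← hsub, hL'.bform_right, hL'.l1_self,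
      mul_one]
  have hqz : ∀ j, bform B' (q j) (z j) = lam' * l1 o' (u j) := fun j => by
    rw [hsub, hq_ext, hρ.bform_apply_left h.isHermitian h.diag, inv_inv, ← hu_ext, ← hsub,
      hL'.bform_left]
  have huB : ∀ j, bform B' (u j) (u j) = bform B' (z j) (z j) := fun j => by
    rw [hsub, hu_ext, hρ.bform_apply h.isHermitian h.diag, ← hsub]
  have hu1 : ∀ j, 0 < l1 o' (u j) := fun j => by
    have h1 := hL'.bform_neg (u := q j) (by rw [hqB]; exact hlam.le) (by linarith [hq1 j])
      (hzneg j) (by rw [hz1]; exact one_pos)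
    rw [hqz] at h1
    exact pos_of_mul_neg_right h1 hlam.le
  have husq : ∀ j, l1 o' (u j) ^ 2 ≤ -bform B' (z j) (z j) / δ := fun j => by
    rw [le_div_iff₀' hδ, ← huB]
    refine hcpt _ (by rw [huB]; exact hzneg j) (hu1 j) fun i => ?_
    rw [hsub, hu_ext, ext0_single]
    exact hwch j i i.2
  have hulim : Tendsto (fun j => l1 o' (u j)) atTop (nhds 0) := by
    have hz' : Tendsto (fun j => -bform B' (z j) (z j) / δ) atTop (nhds 0) := by
      have := (((continuous_bform_self (B := B')).tendsto x).comp hzlim).neg.div_const δ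
      simpa [hx0] using this
    have h2 := hz'.sqrt
    rw [Real.sqrt_zero] at h2
    exact squeeze_zero (fun j => (hu1 j).le) (fun j => Real.le_sqrt_of_sq_le (husq j)) h2
  have hdiff : Tendsto (fun j => nrm o' (q j) - z j) atTop (nhds 0) := by
    refine hL'.tendsto_sub_zero (g := fun j => -lam' * l1 o' (u j))
      (fun j => l1_nrm (by linarith [hq1 j])) hz1 (fun j => ?_) (fun j => (hzneg j).le)
      (fun j => ?_) (by simpa using hulim.const_mul (-lam'))
    · rw [bform_nrm, hqB]
      exact div_nonpos_of_nonpos_of_nonneg hlam.le (by nlinarith [hq1 j])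
    · rw [nrm, bform_smul_left, hqz]
      have h1 : (l1 o' (q j))⁻¹ ≤ 1 := inv_le_one_of_one_le₀ (hq1 j)
      have h2 : 0 ≤ -lam' * l1 o' (u j) := mul_nonneg (by linarith) (hu1 j).le
      nlinarith
  have hqlim : Tendsto (fun j => nrm o' (q j)) atTop (nhds x) := by
    simpa using hdiff.add hzlim
  have hinf : Tendsto (fun j => l1 o' (q j) * l1 o' (q j)) atTop atTop := by
    have h1 : Tendsto (fun j => (l1 o' (q j) * l1 o' (q j))⁻¹) atTop (nhds 0) := by
      have h2 := ((continuous_bform_self (B := B')).tendsto x).comp hqlim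
      rw [hx0] at h2
      have h3 := h2.const_mul lam'⁻¹
      rw [mul_zero] at h3
      refine h3.congr fun j => ?_
      rw [Function.comp_apply, bform_nrm, hqB, div_eq_mul_inv, inv_mul_cancel_left₀ hlam.ne]
    have h4 := (tendsto_nhdsWithin_iff.2 ⟨h1, Eventually.of_forall fun j =>
      show (0 : ℝ) < _ from inv_pos.2 (by nlinarith [hq1 j])⟩).inv_tendsto_nhdsGT_zero
    simpa [Pi.inv_def] using h4
  obtain ⟨φ, hφ, hmono⟩ := strictMono_subseq_of_tendsto_atTop hinf
  refine ⟨fun j => (w (φ j))⁻¹, fun j => inv_mem (hw _), fun a b hab => ?_,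
    hqlim.comp hφ.tendsto_atTop⟩
  refine hmono.injective ?_
  have : q (φ a) = q (φ b) := by
    simp only [hq]
    rw [show (w (φ a))⁻¹ = (w (φ b))⁻¹ from hab]
  simp only [Function.comp_apply, this]

/-- If the normalized orbit of a causal vector of the closed chamber converges along an injective
sequence, so does the orbit of `o`, with the same limit. -/
lemma IsGeometricRep.tendsto_nrm_apply (hρ : IsGeometricRep B cs ρ) (h : IsCompatible B M)
    (hL : IsLorentzian B o lam) {p : Fin n → ℝ} (hp : bform B p p ≤ 0) (hp1 : 0 < l1 o p)
    (hch : ∀ i, bform B (Pi.single i 1) p ≤ 0) {f : ℕ → W} (hf : Function.Injective f)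
    {y : Fin n → ℝ} (hy : Tendsto (fun j => nrm o (ρ (f j) p)) atTop (nhds y)) :
    Tendsto (fun j => nrm o (ρ (f j) o)) atTop (nhds y) := by
  have hlam := hL.neg
  have hinf : Tendsto (fun j => l1 o (ρ (f j) o)) atTop atTop := by
    have := (hρ.tendsto_l1_apply h hL.neg hL.eigen hL.pos).comp hf.tendsto_cofinite
    rwa [Nat.cofinite_eq_atTop] at this
  have hu1 : ∀ j, 0 < l1 o (ρ (f j) o) := fun j => by
    have := l1_mono hL.pos (hρ.le_apply h (p := o) (fun i => by
      rw [hL.bform_right, l1_single]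
      exact (mul_neg_of_neg_of_pos hlam (hL.pos i)).le) (f j))
    linarith [hL.l1_self]
  have hq1 : ∀ j, l1 o p ≤ l1 o (ρ (f j) p) := fun j =>
    l1_mono hL.pos (hρ.le_apply h hch (f j))
  have hdiff : Tendsto (fun j => nrm o (ρ (f j) o) - nrm o (ρ (f j) p)) atTop (nhds 0) := by
    refine hL.tendsto_sub_zero (g := fun j => -lam / l1 o (ρ (f j) o))
      (fun j => l1_nrm (hu1 j).ne') (fun j => l1_nrm (hp1.trans_le (hq1 j)).ne') (fun j => ?_)
      (fun j => ?_) (fun j => ?_) (hinf.const_div_atTop _)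
    · rw [bform_nrm, hρ.bform_apply h.isHermitian h.diag]
      exact div_nonpos_of_nonpos_of_nonneg hL.bform_self_neg.le (mul_self_nonneg _)
    · rw [bform_nrm, hρ.bform_apply h.isHermitian h.diag]
      exact div_nonpos_of_nonpos_of_nonneg hp (mul_self_nonneg _)
    · have hq0 := hp1.trans_le (hq1 j)
      rw [bform_nrm, hρ.bform_apply h.isHermitian h.diag, hL.bform_left, ← neg_div,
        div_le_div_iff₀ (mul_pos (hu1 j) hq0) (hu1 j)]
      have h1 := mul_le_mul_of_nonneg_left (hq1 j)
        (mul_nonneg (neg_nonneg.2 hlam.le) (hu1 j).le)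
      linarith
  simpa using hdiff.add hy

end SpecialSubgroup

lemma mem_convexHull_of_support {n : ℕ} {Δ' : Finset (Fin n)} {o y : Fin n → ℝ}
    (ho : ∀ i, 0 < o i) (hy : 0 ≤ y) (hy0 : ∀ i, i ∉ Δ' → y i = 0) (hy1 : l1 o y = 1) :
    y ∈ convexHull ℝ {v : Fin n → ℝ | ∃ i : Fin n, ∃ _ : i ∈ Δ', v = nrm o (Pi.single i 1)} := by
  have hsum : ∑ i ∈ Δ', (o i * y i) • nrm o (Pi.single i 1 : Fin n → ℝ) = y := by
    ext k
    simp only [nrm, l1_single, Finset.sum_apply, Pi.smul_apply, smul_eq_mul, Pi.single_apply]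
    by_cases hk : k ∈ Δ'
    · rw [Finset.sum_eq_single_of_mem k hk fun i _ hik => by simp [Ne.symm hik]]
      have := (ho k).ne'
      simp only [if_true]
      field_simp
    · rw [hy0 k hk]
      refine Finset.sum_eq_zero fun i hi => ?_
      rw [if_neg (by rintro rfl; exact hk hi), mul_zero, mul_zero]
  rw [← hsum]
  refine (convex_convexHull ℝ _).sum_mem (fun i _ => mul_nonneg (ho i).le (hy i)) ?_
    fun i hi => subset_convexHull ℝ _ ⟨i, hi, rfl⟩
  rw [← hy1, l1]
  exact Finset.sum_subset (Finset.subset_univ _) fun i _ hi => by rw [hy0 i hi, mul_zero]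

lemma support_of_mem_convexHull {n : ℕ} {Δ' : Finset (Fin n)} {o y : Fin n → ℝ}
    (ho : ∀ i, 0 < o i) (hy : y ∈ convexHull ℝ {v : Fin n → ℝ | ∃ i : Fin n, ∃ _ : i ∈ Δ',
      v = nrm o (Pi.single i 1)}) : 0 ≤ y ∧ ∀ i, i ∉ Δ' → y i = 0 := by
  refine convexHull_min (t := {y | 0 ≤ y ∧ ∀ i, i ∉ Δ' → y i = 0}) ?_ ?_ hy
  · rintro _ ⟨i, hi, rfl⟩
    refine ⟨smul_nonneg ?_ (Pi.single_nonneg.2 zero_le_one), fun k hk => ?_⟩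
    · rw [l1_single]
      exact (inv_pos.2 (ho i)).le
    · have hki : k ≠ i := by rintro rfl; exact hk hi
      simp [nrm, hki]
  · rintro u ⟨hu, hu0⟩ v ⟨hv, hv0⟩ a b ha hb -
    refine ⟨add_nonneg (smul_nonneg ha hu) (smul_nonneg hb hv), fun i hi => ?_⟩
    simp [hu0 i hi, hv0 i hi]

theorem limit_set_of_cocompact_special_subgroup_embeds
    (n : ℕ) (B : Matrix (Fin n) (Fin n) ℝ) (M : CoxeterMatrix (Fin n))
    (hherm : B.IsHermitian)
    (hdiag : ∀ i, B i i = 1)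
    (hfin : ∀ i j, M i j ≠ 0 → B i j = -Real.cos (Real.pi / (M i j : ℝ)))
    (hinf : ∀ i j, M i j = 0 → B i j ≤ -1)
    (hsig_neg : Nat.card {i : Fin n // hherm.eigenvalues i < 0} = 1)
    (hsig_pos : Nat.card {i : Fin n // 0 < hherm.eigenvalues i} = n - 1)
    (o : Fin n → ℝ) (lam : ℝ) (hlam : lam < 0) (ho : B.mulVec o = lam • o)
    (hopos : ∀ i, 0 < o i) (honorm : ∑ i, (o i) ^ 2 = 1)
    (W : Type*) [Group W] (cs : CoxeterSystem M W)
    (ρ : W →* Module.End ℝ (Fin n → ℝ))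
    (hρ : ∀ (i : Fin n) (v : Fin n → ℝ),
      ρ (cs.simple i) v = v - (2 * bform B (Pi.single i 1) v) • (Pi.single i 1 : Fin n → ℝ))
    -- the special subgroup `W' = ⟨S'⟩`, `S' ⊆ S`
    (Δ' : Finset (Fin n))
    (B' : Matrix {i // i ∈ Δ'} {i // i ∈ Δ'} ℝ)
    (hB' : B' = B.submatrix (Subtype.val : {i // i ∈ Δ'} → Fin n) Subtype.val)
    (hherm' : B'.IsHermitian)
    -- the bilinear form of `W'` has signature `(|S'| - 1, 1)`
    (hsig_neg' : Nat.card {i : {i // i ∈ Δ'} // hherm'.eigenvalues i < 0} = 1)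
    (hsig_pos' : Nat.card {i : {i // i ∈ Δ'} // 0 < hherm'.eigenvalues i} = Δ'.card - 1)
    (o' : {i // i ∈ Δ'} → ℝ) (lam' : ℝ) (hlam' : lam' < 0)
    (ho' : B'.mulVec o' = lam' • o') (hopos' : ∀ i, 0 < o' i)
    (honorm' : ∑ i, (o' i) ^ 2 = 1)
    -- the normalized action of `W'` on its phase space is cocompact:
    -- the closure of its fundamental region `K'` is compact and contained in `D'`
    (hcocompact :
      IsCompact (closure {v : {i // i ∈ Δ'} → ℝ | l1 o' v = 1 ∧ bform B' v v < 0 ∧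
        ∀ i : {i // i ∈ Δ'}, bform B' (Pi.single i 1) v < 0}) ∧
      closure {v : {i // i ∈ Δ'} → ℝ | l1 o' v = 1 ∧ bform B' v v < 0 ∧
          ∀ i : {i // i ∈ Δ'}, bform B' (Pi.single i 1) v < 0} ⊆
        {v : {i // i ∈ Δ'} → ℝ | l1 o' v = 1 ∧ bform B' v v < 0}) :
    -- Λ(W') is canonically identified with Λ(W) ∩ conv(Δ̂')
    Set.BijOn (fun v : {i // i ∈ Δ'} → ℝ => nrm o (ext0 Δ' v))
      -- Λ(W'): accumulation points of the normalized `W'`-orbit of `o'`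
      {x : {i // i ∈ Δ'} → ℝ | ∃ f : ℕ → W,
        (∀ j, f j ∈ Subgroup.closure (cs.simple '' (Δ' : Set (Fin n)))) ∧
        Function.Injective f ∧
        Tendsto (fun j => nrm o' (fun i : {i // i ∈ Δ'} => ρ (f j) (ext0 Δ' o') i))
          atTop (nhds x)}
      -- Λ(W) ∩ conv(Δ̂')
      ({x : Fin n → ℝ | ∃ f : ℕ → W, Function.Injective f ∧
          Tendsto (fun j => nrm o (ρ (f j) o)) atTop (nhds x)} ∩
        convexHull ℝ {v : Fin n → ℝ | ∃ i : Fin n, ∃ _ : i ∈ Δ',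
          v = nrm o (Pi.single i 1)}) ∧
    ContinuousOn (fun v : {i // i ∈ Δ'} → ℝ => nrm o (ext0 Δ' v))
      {x : {i // i ∈ Δ'} → ℝ | ∃ f : ℕ → W,
        (∀ j, f j ∈ Subgroup.closure (cs.simple '' (Δ' : Set (Fin n)))) ∧
        Function.Injective f ∧
        Tendsto (fun j => nrm o' (fun i : {i // i ∈ Δ'} => ρ (f j) (ext0 Δ' o') i))
          atTop (nhds x)} := by
  subst hB'
  have hC : IsCompatible B M := ⟨hherm, hdiag, hfin, hinf⟩
  have hG : IsGeometricRep B cs ρ := hρ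
  have hL : IsLorentzian B o lam := IsLorentzian.of_signature hherm hsig_neg
    (by rw [hsig_pos, Fintype.card_fin]) hlam ho hopos honorm
  have hL' := IsLorentzian.of_signature hherm' hsig_neg'
    (by rw [hsig_pos', Fintype.card_coe]) hlam' ho' hopos' honorm'
  obtain ⟨δ, hδ, hcpt⟩ := hL'.exists_bform_self_le_of_cocompact hcocompact.1 hcocompact.2
  have hp_ch := bform_single_ext0_nonpos hC hL'
  have hp0 : 0 ≤ ext0 Δ' o' := ext0_nonneg fun i => (hopos' i).le
  have hpB : bform B (ext0 Δ' o') (ext0 Δ' o') < 0 := by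
    rw [← bform_submatrix]
    exact hL'.bform_self_neg
  have hp1 : 0 < l1 o (ext0 Δ' o') := l1_pos hopos hp0 fun h => by
    rw [h] at hpB
    simp [bform] at hpB
  have hlimit : ∀ {x : {i // i ∈ Δ'} → ℝ} {f : ℕ → W},
      Tendsto (fun j => nrm o' (fun i : {i // i ∈ Δ'} => ρ (f j) (ext0 Δ' o') i)) atTop
        (nhds x) → 0 ≤ x ∧ l1 o' x = 1 ∧ 0 < l1 o (ext0 Δ' x) := by
    intro x f hf
    have hq1 := fun j => one_le_l1_restrict_apply hG hC hL' (f j)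
    have hx0 : 0 ≤ x := ge_of_tendsto' hf fun j =>
      smul_nonneg (inv_nonneg.2 (by linarith [hq1 j]))
        fun i => (hp0.trans (hG.le_apply hC hp_ch (f j))) i
    have hx1 : l1 o' x = 1 := by
      refine tendsto_nhds_unique (((continuous_l1 o').tendsto x).comp hf) ?_
      refine tendsto_const_nhds.congr fun j => ?_
      exact (l1_nrm (by linarith [hq1 j])).symm
    refine ⟨hx0, hx1, l1_pos hopos (ext0_nonneg hx0) fun h => ?_⟩
    have : x = 0 := ext0_injective (by rw [h]; ext i; simp [ext0])
    rw [this] at hx1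
    simp [l1] at hx1
  have hcont : ContinuousOn (fun v : {i // i ∈ Δ'} → ℝ => nrm o (ext0 Δ' v))
      {x | 0 < l1 o (ext0 Δ' x)} := fun x hx =>
    ((continuousAt_nrm (ne_of_gt hx)).comp continuous_ext0.continuousAt).continuousWithinAt
  refine ⟨⟨?_, ?_, ?_⟩, hcont.mono ?_⟩
  · rintro x ⟨f, hfW, hfinj, hf⟩
    obtain ⟨hx0, -, hxo⟩ := hlimit hf
    refine ⟨⟨f, hfinj, hG.tendsto_nrm_apply hC hL hpB.le hp1 hp_ch hfinj ?_⟩, ?_⟩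
    · have hc : Tendsto (nrm o ∘ ext0 Δ') (nhds x) (nhds (nrm o (ext0 Δ' x))) :=
        (continuousAt_nrm hxo.ne').comp continuous_ext0.continuousAt
      refine (hc.comp hf).congr fun j => ?_
      have hq1 := one_le_l1_restrict_apply hG hC hL' (f j)
      rw [Function.comp_apply, Function.comp_apply, nrm_ext0_nrm o (by linarith),
        hG.ext0_apply (hfW j)]
    · refine mem_convexHull_of_support hopos
        (smul_nonneg (inv_nonneg.2 hxo.le) (ext0_nonneg hx0)) (fun i hi => ?_) (l1_nrm hxo.ne')
      simp [nrm, ext0_of_notMem x hi]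
  · rintro x ⟨f, -, -, hf⟩ y ⟨g, -, -, hg⟩ hxy
    obtain ⟨-, hx1, hxo⟩ := hlimit hf
    obtain ⟨-, hy1, hyo⟩ := hlimit hg
    have hinj : (l1 o (ext0 Δ' x))⁻¹ • x = (l1 o (ext0 Δ' y))⁻¹ • y :=
      ext0_injective (by rw [ext0_smul, ext0_smul]; exact hxy)
    rw [← nrm_eq_self hx1, ← nrm_eq_self hy1, ← nrm_smul o' (inv_ne_zero hxo.ne') x,
      hinj, nrm_smul o' (inv_ne_zero hyo.ne')]
  · rintro y ⟨⟨f, hfinj, hf⟩, hyconv⟩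
    obtain ⟨hy0, hysupp⟩ := support_of_mem_convexHull hopos hyconv
    have hinf' : Tendsto (fun j => l1 o (ρ (f j) o)) atTop atTop := by
      have := (hG.tendsto_l1_apply hC hlam ho hopos).comp hfinj.tendsto_cofinite
      rwa [Nat.cofinite_eq_atTop] at this
    have hy1 : l1 o y = 1 := by
      refine tendsto_nhds_unique (((continuous_l1 o).tendsto y).comp hf) ?_
      refine tendsto_const_nhds.congr' ?_
      filter_upwards [hinf'.eventually_gt_atTop 0] with j hj
      exact (l1_nrm hj.ne').symm
    have hyB : bform B y y = 0 := by
      refine tendsto_nhds_unique (((continuous_bform_self (B := B)).tendsto y).comp hf) ?_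
      refine ((hinf'.atTop_mul_atTop₀ hinf').const_div_atTop (bform B o o)).congr fun j => ?_
      rw [Function.comp_apply, bform_nrm, hG.bform_apply hherm hdiag]
    set y' : {i // i ∈ Δ'} → ℝ := fun i => y i with hy'
    have hyext : ext0 Δ' y' = y := ext0_restrict hysupp
    have hy'0 : 0 ≤ y' := fun i => hy0 i
    have hl : 0 < l1 o' y' := l1_pos hopos' hy'0 fun h => by
      have : y = 0 := by rw [← hyext, h]; ext i; simp [ext0]
      rw [this] at hy1
      simp [l1] at hy1
    obtain ⟨g, hgW, hginj, hg⟩ := exists_tendsto_of_isotropic hG hC hL hL' hδ hcpt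
      (x := nrm o' y') (smul_nonneg (inv_nonneg.2 hl.le) hy'0) (l1_nrm hl.ne')
      (by rw [bform_nrm, bform_submatrix, hyext, hyB, zero_div])
    refine ⟨nrm o' y', ⟨g, hgW, hginj, hg⟩, ?_⟩
    change nrm o (ext0 Δ' (nrm o' y')) = y
    rw [nrm_ext0_nrm o hl.ne', hyext, nrm_eq_self hy1]
  · rintro x ⟨f, -, -, hf⟩
    exact (hlimit hf).2.2

end
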